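/- arXiv:2404.06985 — 2 statements merged into one kernel-verified Lean document; each statement's English description precedes it below -/
import Mathlib

section
/- Let T > 0 and let X₀, X₁, X ⊆ ℝ^n and U ⊆ ℝ^n be compact sets with X₀ ⊆ X, X₁ ⊆ X, and U convex with 0 in its interior. Then exactly one of the following holds: (i) there exist a Borel probability measure μ₀ supported in X₀, a finite Borel measure μ_T supported in X₁, and a finite Borel measure μ supported in [0,T] × X × U such that for every continuously differentiable v : ℝ × ℝ^n → ℝ, ∫ v(T,x) dμ_T(x) = ∫ v(0,x) dμ₀(x) + ∫ (∂_t v(t,x) + ⟨u, ∇_x v(t,x)⟩) dμ(t,x,u); (ii) there exists a continuously differentiable function v : ℝ × ℝ^n → ℝ such that v(0,x) ≥ 1 for all x ∈ X₀, v(T,x) ≤ 0 for all x ∈ X₁, and ∂_t v(t,x) + ⟨u, ∇_x v(t,x)⟩ ≥ 0 for all (t,x,u) ∈ [0,T] × X × U. -/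
open MeasureTheory

/-- A positive linear functional on `C(K, ℝ)`, with `K` compact, is integration against a finite
measure. -/
theorem exists_isFiniteMeasure_integral_eq {K : Type*} [TopologicalSpace K] [CompactSpace K]
    [T2Space K] [MeasurableSpace K] [BorelSpace K] (φ : C(K, ℝ) →ₗ[ℝ] ℝ)
    (hφ : ∀ f : C(K, ℝ), (∀ x, 0 ≤ f x) → 0 ≤ φ f) :
    ∃ μ : Measure K, IsFiniteMeasure μ ∧ ∀ f : C(K, ℝ), ∫ x, f x ∂μ = φ f := by
  let ψ : CompactlySupportedContinuousMap K ℝ →ₗ[ℝ] ℝ :=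
    { toFun := fun f => φ f.toContinuousMap
      map_add' := fun f g => φ.map_add f.toContinuousMap g.toContinuousMap
      map_smul' := fun c f => φ.map_smul c f.toContinuousMap }
  let Λ : CompactlySupportedContinuousMap K ℝ →ₚ[ℝ] ℝ :=
    PositiveLinearMap.mk₀ ψ fun f hf => hφ f.toContinuousMap fun x => hf x
  exact ⟨RealRMK.rieszMeasure Λ, inferInstance, fun f =>
    RealRMK.integral_rieszMeasure Λ (CompactlySupportedContinuousMap.continuousMapEquiv f)⟩

theorem ContinuousMap.isOpen_setOf_forall_pos {K : Type*} [TopologicalSpace K] [CompactSpace K] :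
    IsOpen {f : C(K, ℝ) | ∀ x, 0 < f x} := by
  simpa [Set.MapsTo] using
    ContinuousMap.isOpen_setOfPred_mapsTo (X := K) isCompact_univ (isOpen_Ioi (a := (0 : ℝ)))

/-- A linear functional that is positive on an open convex set and vanishes on a subspace disjoint
from it. -/
theorem exists_strongDual_eq_zero_of_disjoint {E : Type*} [TopologicalSpace E] [AddCommGroup E]
    [Module ℝ E] [IsTopologicalAddGroup E] [ContinuousSMul ℝ E] {s : Set E} (hs : Convex ℝ s)
    (hso : IsOpen s) (W : Submodule ℝ E) (hW : Disjoint s W) :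
    ∃ f : StrongDual ℝ E, (∀ w ∈ W, f w = 0) ∧ ∀ x ∈ s, 0 < f x := by
  obtain ⟨f, u, hfs, hfW⟩ := geometric_hahn_banach_open hs hso W.convex hW
  have hu : u ≤ 0 := by simpa using hfW 0 W.zero_mem
  have hzero : ∀ w ∈ W, f w = 0 := by
    intro w hw
    by_contra hne
    have h := hfW (((u - 1) / f w) • w) (W.smul_mem _ hw)
    rw [map_smul, smul_eq_mul, div_mul_cancel₀ _ hne] at h
    linarith
  refine ⟨-f, fun w hw => by simp [hzero w hw], fun x hx => ?_⟩
  have := hfs x hx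
  simp only [neg_apply]
  linarith

/-- A subspace of `C(A, ℝ) × C(B, ℝ) × C(D, ℝ)` containing no triple of strictly positive functions
is annihilated by a nonzero triple of finite measures. -/
theorem exists_measures_annihilating {A B D : Type*}
    [TopologicalSpace A] [CompactSpace A] [T2Space A] [MeasurableSpace A] [BorelSpace A]
    [TopologicalSpace B] [CompactSpace B] [T2Space B] [MeasurableSpace B] [BorelSpace B]
    [TopologicalSpace D] [CompactSpace D] [T2Space D] [MeasurableSpace D] [BorelSpace D]
    (W : Submodule ℝ (C(A, ℝ) × C(B, ℝ) × C(D, ℝ)))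
    (hW : ∀ w ∈ W, ¬ ((∀ a, 0 < w.1 a) ∧ (∀ b, 0 < w.2.1 b) ∧ ∀ d, 0 < w.2.2 d)) :
    ∃ (α : Measure A) (β : Measure B) (δ : Measure D),
      IsFiniteMeasure α ∧ IsFiniteMeasure β ∧ IsFiniteMeasure δ ∧
      0 < α.real Set.univ + β.real Set.univ + δ.real Set.univ ∧
      ∀ w ∈ W, ∫ a, w.1 a ∂α + ∫ b, w.2.1 b ∂β + ∫ d, w.2.2 d ∂δ = 0 := by
  let s : Set (C(A, ℝ) × C(B, ℝ) × C(D, ℝ)) :=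
    {f | ∀ a, 0 < f a} ×ˢ {f | ∀ b, 0 < f b} ×ˢ {f | ∀ d, 0 < f d}
  have hs : Convex ℝ s := by
    refine Convex.prod ?_ (Convex.prod ?_ ?_) <;>
    · intro f hf g hg a b ha hb hab x
      exact convex_Ioi (0 : ℝ) (hf x) (hg x) ha hb hab
  have hso : IsOpen s := ContinuousMap.isOpen_setOf_forall_pos.prod
    (ContinuousMap.isOpen_setOf_forall_pos.prod ContinuousMap.isOpen_setOf_forall_pos)
  obtain ⟨Λ, hΛW, hΛs⟩ := exists_strongDual_eq_zero_of_disjoint hs hso W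
    (Set.disjoint_left.2 fun w hw hw' => hW w hw' hw)
  have hΛ : ∀ w : C(A, ℝ) × C(B, ℝ) × C(D, ℝ),
      (∀ a, 0 ≤ w.1 a) → (∀ b, 0 ≤ w.2.1 b) → (∀ d, 0 ≤ w.2.2 d) → 0 ≤ Λ w := by
    intro w h₁ h₂ h₃
    have h1 : (1 : C(A, ℝ) × C(B, ℝ) × C(D, ℝ)) ∈ s :=
      ⟨fun _ => one_pos, fun _ => one_pos, fun _ => one_pos⟩
    have hone := hΛs 1 h1
    refine le_of_forall_pos_le_add fun ε hε => ?_
    have hc : 0 < ε / Λ 1 := div_pos hε hone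
    have hmem : w + (ε / Λ 1) • 1 ∈ s := by
      refine ⟨fun x => ?_, fun x => ?_, fun x => ?_⟩
      · simpa using add_pos_of_nonneg_of_pos (h₁ x) hc
      · simpa using add_pos_of_nonneg_of_pos (h₂ x) hc
      · simpa using add_pos_of_nonneg_of_pos (h₃ x) hc
    have h := hΛs _ hmem
    rw [map_add, map_smul, smul_eq_mul, div_mul_cancel₀ _ hone.ne'] at h
    exact h.le
  obtain ⟨α, hα, hαi⟩ := exists_isFiniteMeasure_integral_eq
    ((Λ : _ →ₗ[ℝ] ℝ) ∘ₗ LinearMap.inl ℝ C(A, ℝ) (C(B, ℝ) × C(D, ℝ))) fun f hf =>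
      hΛ (f, 0) hf (fun _ => le_rfl) fun _ => le_rfl
  obtain ⟨β, hβ, hβi⟩ := exists_isFiniteMeasure_integral_eq
    ((Λ : _ →ₗ[ℝ] ℝ) ∘ₗ LinearMap.inr ℝ C(A, ℝ) (C(B, ℝ) × C(D, ℝ)) ∘ₗ
      LinearMap.inl ℝ C(B, ℝ) C(D, ℝ)) fun f hf =>
      hΛ (0, f, 0) (fun _ => le_rfl) hf fun _ => le_rfl
  obtain ⟨δ, hδ, hδi⟩ := exists_isFiniteMeasure_integral_eq
    ((Λ : _ →ₗ[ℝ] ℝ) ∘ₗ LinearMap.inr ℝ C(A, ℝ) (C(B, ℝ) × C(D, ℝ)) ∘ₗ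
      LinearMap.inr ℝ C(B, ℝ) C(D, ℝ)) fun f hf =>
      hΛ (0, 0, f) (fun _ => le_rfl) (fun _ => le_rfl) hf
  have hsum : ∀ w : C(A, ℝ) × C(B, ℝ) × C(D, ℝ),
      ∫ a, w.1 a ∂α + ∫ b, w.2.1 b ∂β + ∫ d, w.2.2 d ∂δ = Λ w := by
    intro w
    rw [hαi, hβi, hδi]
    simp [← map_add]
  refine ⟨α, β, δ, hα, hβ, hδ, ?_, fun w hw => (hsum w).trans (hΛW w hw)⟩
  have h := hsum 1
  simp only [Prod.fst_one, Prod.snd_one, ContinuousMap.one_apply, integral_const, smul_eq_mul,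
    mul_one] at h
  rw [h]
  exact hΛs 1 ⟨fun _ => one_pos, fun _ => one_pos, fun _ => one_pos⟩

theorem integrable_of_continuous_of_isCompact {Y : Type*} [TopologicalSpace Y] [T2Space Y]
    [MeasurableSpace Y] [BorelSpace Y] {μ : Measure Y} [IsFiniteMeasure μ] {K : Set Y}
    (hK : IsCompact K) (hμ : μ Kᶜ = 0) {f : Y → ℝ} (hf : Continuous f) : Integrable f μ := by
  rw [← Measure.restrict_eq_self_of_ae_mem (mem_ae_iff.2 hμ)]
  exact hf.continuousOn.integrableOn_compact hK

theorem continuous_fderiv_along {E : Type*} [NormedAddCommGroup E] [NormedSpace ℝ E]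
    {v : ℝ × E → ℝ} (hv : ContDiff ℝ 1 v) :
    Continuous fun p : ℝ × E × E => fderiv ℝ v (p.1, p.2.1) (1, p.2.2) :=
  ((hv.continuous_fderiv one_ne_zero).comp (by fun_prop)).clm_apply (by fun_prop)

theorem map_subtype_val_compl {Y : Type*} [MeasurableSpace Y] {K : Set Y} (hK : MeasurableSet K)
    (μ : Measure K) : μ.map Subtype.val Kᶜ = 0 := by
  rw [Measure.map_apply measurable_subtype_coe hK.compl]
  simp

/-- If no `C¹` function is positive on `{0} × X₀`, negative on `{T} × X₁` and strictly increasing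
along every direction `(1, u)`, then the measure linear program is feasible. -/
theorem measure_LP_feasible_of_no_strict_barrier {E : Type*} [NormedAddCommGroup E]
    [NormedSpace ℝ E] [MeasurableSpace E] [BorelSpace E] [SecondCountableTopology E]
    (T : ℝ) {X₀ X₁ X U : Set E}
    (hX₀ : IsCompact X₀) (hX₁ : IsCompact X₁) (hX : IsCompact X) (hU : IsCompact U)
    (hno : ∀ v : ℝ × E → ℝ, ContDiff ℝ 1 v → (∀ x ∈ X₀, 0 < v (0, x)) → (∀ x ∈ X₁, v (T, x) < 0) →
      ¬ ∀ t ∈ Set.Icc (0 : ℝ) T, ∀ x ∈ X, ∀ u ∈ U, 0 < fderiv ℝ v (t, x) (1, u)) :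
    ∃ (μ₀ μT : Measure E) (μ : Measure (ℝ × E × E)),
      IsProbabilityMeasure μ₀ ∧ IsFiniteMeasure μT ∧ IsFiniteMeasure μ ∧
      μ₀ X₀ᶜ = 0 ∧ μT X₁ᶜ = 0 ∧ μ (Set.Icc (0 : ℝ) T ×ˢ X ×ˢ U)ᶜ = 0 ∧
      ∀ v : ℝ × E → ℝ, ContDiff ℝ 1 v →
        ∫ x, v (T, x) ∂μT =
          ∫ x, v (0, x) ∂μ₀ + ∫ p, fderiv ℝ v (p.1, p.2.1) (1, p.2.2) ∂μ := by
  have hD : IsCompact (Set.Icc (0 : ℝ) T ×ˢ X ×ˢ U) := isCompact_Icc.prod (hX.prod hU)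
  set D : Set (ℝ × E × E) := Set.Icc (0 : ℝ) T ×ˢ X ×ˢ U
  have := isCompact_iff_compactSpace.mp hX₀
  have := isCompact_iff_compactSpace.mp hX₁
  have := isCompact_iff_compactSpace.mp hD
  let W : Submodule ℝ (C(X₀, ℝ) × C(X₁, ℝ) × C(D, ℝ)) :=
    { carrier := {w | ∃ v : ℝ × E → ℝ, ContDiff ℝ 1 v ∧ (∀ x, w.1 x = v (0, x)) ∧
        (∀ x, w.2.1 x = -v (T, x)) ∧ ∀ p, w.2.2 p = fderiv ℝ v (p.1.1, p.1.2.1) (1, p.1.2.2)}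
      zero_mem' := ⟨0, contDiff_const, by simp, by simp, by simp⟩
      add_mem' := by
        rintro w w' ⟨v, hv, h₁, h₂, h₃⟩ ⟨v', hv', h₁', h₂', h₃'⟩
        refine ⟨v + v', hv.add hv', fun x => ?_, fun x => ?_, fun p => ?_⟩
        · simp [h₁, h₁']
        · simp [h₂, h₂', add_comm]
        · rw [fderiv_add (hv.differentiable one_ne_zero _) (hv'.differentiable one_ne_zero _)]
          simp [h₃, h₃']
      smul_mem' := by
        rintro c w ⟨v, hv, h₁, h₂, h₃⟩
        refine ⟨c • v, hv.const_smul c, fun x => ?_, fun x => ?_, fun p => ?_⟩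
        · simp [h₁]
        · simp [h₂]
        · rw [fderiv_const_smul (hv.differentiable one_ne_zero _)]
          simp [h₃] }
  obtain ⟨α, β, δ, hα, hβ, hδ, hpos, hann⟩ := exists_measures_annihilating W (by
    rintro w ⟨v, hv, h₁, h₂, h₃⟩ ⟨p₁, p₂, p₃⟩
    refine hno v hv (fun x hx => ?_) (fun x hx => ?_) fun t ht x hx u hu => ?_
    · simpa [h₁] using p₁ ⟨x, hx⟩
    · simpa [h₂] using p₂ ⟨x, hx⟩
    · simpa [h₃] using p₃ ⟨(t, x, u), ht, hx, hu⟩)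
  have key : ∀ v : ℝ × E → ℝ, ContDiff ℝ 1 v →
      ∫ x : X₁, v (T, x) ∂β = ∫ x : X₀, v (0, x) ∂α +
        ∫ p : D, fderiv ℝ v (p.1.1, p.1.2.1) (1, p.1.2.2) ∂δ := by
    intro v hv
    have hvc := hv.continuous
    have h := hann
      (⟨fun x => v (0, x), by fun_prop⟩, ⟨fun x => -v (T, x), by fun_prop⟩,
        ⟨fun p => fderiv ℝ v (p.1.1, p.1.2.1) (1, p.1.2.2),
          (continuous_fderiv_along hv).comp continuous_subtype_val⟩)
      ⟨v, hv, fun _ => rfl, fun _ => rfl, fun _ => rfl⟩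
    simp only [ContinuousMap.coe_mk, integral_neg] at h
    linarith
  have hβα : β.real Set.univ = α.real Set.univ := by
    simpa using key (fun _ => 1) contDiff_const
  have hδα : T * β.real Set.univ = δ.real Set.univ := by
    simpa [fderiv_fst, mul_comm] using key Prod.fst contDiff_fst
  have hm : 0 < α.real Set.univ := by
    rcases (measureReal_nonneg (μ := α) (s := Set.univ)).eq_or_lt with h | h
    · rw [hβα, ← h] at hδα
      rw [hβα, ← h, ← hδα] at hpos
      simp at hpos
    · exact h
  set m := α.real Set.univ with hmdef
  have hc : ENNReal.ofReal m⁻¹ ≠ ⊤ := ENNReal.ofReal_ne_top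
  have hmap {Y : Type _} [MeasurableSpace Y] {K : Set Y} (hK : MeasurableSet K) (ν : Measure K)
      (f : Y → ℝ) : ∫ y, f y ∂(ENNReal.ofReal m⁻¹ • ν.map Subtype.val) = m⁻¹ * ∫ y : K, f y ∂ν := by
    rw [integral_smul_measure, (MeasurableEmbedding.subtype_coe hK).integral_map,
      ENNReal.toReal_ofReal (inv_pos.2 hm).le, smul_eq_mul]
  refine ⟨ENNReal.ofReal m⁻¹ • α.map Subtype.val, ENNReal.ofReal m⁻¹ • β.map Subtype.val,
    ENNReal.ofReal m⁻¹ • δ.map Subtype.val, ⟨?_⟩, Measure.smul_finite _ hc,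
    Measure.smul_finite _ hc, ?_, ?_, ?_, fun v hv => ?_⟩
  · rw [Measure.smul_apply, Measure.map_apply measurable_subtype_coe MeasurableSet.univ,
      Set.preimage_univ, ← ofReal_measureReal, smul_eq_mul, ← ENNReal.ofReal_mul (inv_pos.2 hm).le,
      ← hmdef, inv_mul_cancel₀ hm.ne', ENNReal.ofReal_one]
  · rw [Measure.smul_apply, map_subtype_val_compl hX₀.measurableSet, smul_zero]
  · rw [Measure.smul_apply, map_subtype_val_compl hX₁.measurableSet, smul_zero]
  · rw [Measure.smul_apply, map_subtype_val_compl hD.measurableSet, smul_zero]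
  · rw [hmap hX₁.measurableSet β fun x => v (T, x), hmap hX₀.measurableSet α fun x => v (0, x),
      hmap hD.measurableSet δ fun p => fderiv ℝ v (p.1, p.2.1) (1, p.2.2), key v hv, mul_add]

open MeasureTheory

/-- Theorem of alternatives (Theorem 4.1 of the paper): either the occupation
measure LP encoding a controlled single-integrator path from `X₀` to `X₁`
inside `X` over horizon `[0,T]` is feasible, or a time-dependent barrier
function exists — and exactly one of the two holds. -/
theorem measure_LP_barrier_alternative {n : ℕ} (T : ℝ) (hT : 0 < T)
    (X₀ X₁ X U : Set (EuclideanSpace ℝ (Fin n)))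
    (hX₀ : IsCompact X₀) (hX₁ : IsCompact X₁) (hX : IsCompact X) (hU : IsCompact U)
    (hX₀X : X₀ ⊆ X) (hX₁X : X₁ ⊆ X)
    (hUconv : Convex ℝ U) (hU0 : (0 : EuclideanSpace ℝ (Fin n)) ∈ interior U) :
    Xor'
      (∃ (μ₀ μT : Measure (EuclideanSpace ℝ (Fin n)))
          (μ : Measure (ℝ × EuclideanSpace ℝ (Fin n) × EuclideanSpace ℝ (Fin n))),
        IsProbabilityMeasure μ₀ ∧ IsFiniteMeasure μT ∧ IsFiniteMeasure μ ∧
        μ₀ X₀ᶜ = 0 ∧ μT X₁ᶜ = 0 ∧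
        μ (Set.Icc (0 : ℝ) T ×ˢ X ×ˢ U)ᶜ = 0 ∧
        ∀ v : ℝ × EuclideanSpace ℝ (Fin n) → ℝ, ContDiff ℝ 1 v →
          ∫ x, v (T, x) ∂μT =
            ∫ x, v (0, x) ∂μ₀ + ∫ p, fderiv ℝ v (p.1, p.2.1) (1, p.2.2) ∂μ)
      (∃ v : ℝ × EuclideanSpace ℝ (Fin n) → ℝ, ContDiff ℝ 1 v ∧
        (∀ x ∈ X₀, 1 ≤ v (0, x)) ∧
        (∀ x ∈ X₁, v (T, x) ≤ 0) ∧
        (∀ t ∈ Set.Icc (0 : ℝ) T, ∀ x ∈ X, ∀ u ∈ U,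
          0 ≤ fderiv ℝ v (t, x) (1, u))) := by
  refine (xor_iff_or_and_not_and _ _).2 ⟨?_, ?_⟩
  · by_contra! hcon
    obtain ⟨hinf, hbar⟩ := hcon
    obtain ⟨μ₀, μT, μ, h₀, h₁, h₂, h₃, h₄, h₅, h₆⟩ :=
      measure_LP_feasible_of_no_strict_barrier T hX₀ hX₁ hX hU (by
        intro v hv hv₀ hv₁ hLv
        have hvc := hv.continuous
        obtain ⟨c, hc, hcv⟩ : ∃ c : ℝ, 0 < c ∧ ∀ x ∈ X₀, c ≤ v (0, x) :=
          hX₀.exists_forall_le' (f := fun x => v (0, x)) (by fun_prop) hv₀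
        obtain ⟨t, ht, x, hx, u, hu, hlt⟩ := hbar (c⁻¹ • v) (hv.const_smul c⁻¹)
          (fun x hx => by
            rw [Pi.smul_apply, smul_eq_mul, ← inv_mul_cancel₀ hc.ne']
            exact mul_le_mul_of_nonneg_left (hcv x hx) (inv_pos.2 hc).le)
          (fun x hx => mul_nonpos_of_nonneg_of_nonpos (inv_pos.2 hc).le (hv₁ x hx).le)
        rw [fderiv_const_smul (hv.differentiable one_ne_zero _)] at hlt
        exact hlt.not_ge (mul_nonneg (inv_pos.2 hc).le (hLv t ht x hx u hu).le))
    obtain ⟨v, hv, hne⟩ := hinf μ₀ μT μ h₀ h₁ h₂ h₃ h₄ h₅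
    exact hne (h₆ v hv)
  · rintro ⟨⟨μ₀, μT, μ, h₀, h₁, h₂, h₃, h₄, h₅, h₆⟩, v, hv, hv₀, hv₁, hLv⟩
    have hvc := hv.continuous
    have hT' : ∫ x, v (T, x) ∂μT ≤ 0 := by
      refine integral_nonpos_of_ae ?_
      filter_upwards [mem_ae_iff.2 h₄] with x hx using hv₁ x hx
    have hμ : 0 ≤ ∫ p, fderiv ℝ v (p.1, p.2.1) (1, p.2.2) ∂μ := by
      refine integral_nonneg_of_ae ?_
      filter_upwards [mem_ae_iff.2 h₅] with p hp using hLv _ hp.1 _ hp.2.1 _ hp.2.2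
    have h0 : 1 ≤ ∫ x, v (0, x) ∂μ₀ := by
      calc (1 : ℝ) = ∫ _, (1 : ℝ) ∂μ₀ := by simp
        _ ≤ ∫ x, v (0, x) ∂μ₀ := by
          refine integral_mono_ae (integrable_const _)
            (integrable_of_continuous_of_isCompact hX₀ h₃ (by fun_prop)) ?_
          filter_upwards [mem_ae_iff.2 h₃] with x hx using hv₀ x hx
    linarith [h₆ v hv]
end

section
/- Let T > 0 and let X₀, X₁, X ⊆ ℝ^n be compact sets with X₀ nonempty, X₀ ⊆ X, and X₁ ⊆ X. Suppose there exists a continuously differentiable function ṽ : ℝ × ℝ^n → ℝ with ṽ(0,x) > 0 for all x ∈ X₀, ṽ(T,x) < 0 for all x ∈ X₁, and ∂_t ṽ(t,x) + ⟨u, ∇_x ṽ(t,x)⟩ > 0 for all (t,x,u) ∈ [0,T] × X × [-1,1]^n. Then there exists a polynomial function V : ℝ × ℝ^n → ℝ (a polynomial in the n+1 variables t, x₁, …, x_n with real coefficients) satisfying the same three strict conditions: V(0,x) > 0 for all x ∈ X₀, V(T,x) < 0 for all x ∈ X₁, and ∂_t V(t,x) + ⟨u, ∇_x V(t,x)⟩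 > 0 for all (t,x,u) ∈ [0,T] × X × [-1,1]^n. -/
open MeasureTheory Filter Topology

/-- Normalized powers of a function with a unique maximum at the origin form an approximate
identity for convolution, uniformly on compact sets. -/
theorem eventually_norm_setIntegral_pow_smul_sub_lt
    {E G : Type*} [NormedAddCommGroup E] [MeasurableSpace E] [BorelSpace E]
    [NormedAddCommGroup G] [NormedSpace ℝ G] [CompleteSpace G]
    (μ : Measure E) [IsLocallyFiniteMeasure μ] [μ.IsOpenPosMeasure]
    {S K : Set E} (hS : IsCompact S) (hK : IsCompact K) (hS₀ : S ∈ 𝓝 (0 : E))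
    {c : E → ℝ} (hc : Continuous c) (hmax : ∀ y ∈ S, y ≠ 0 → c y < c 0)
    (hnonneg : ∀ y ∈ S, 0 ≤ c y) (hpos : 0 < c 0)
    {F : E → G} (hF : Continuous F) {ε : ℝ} (hε : 0 < ε) :
    ∀ᶠ k : ℕ in atTop, ∀ x ∈ K,
      ‖(∫ y in S, c y ^ k ∂μ)⁻¹ • (∫ y in S, c y ^ k • F (x - y) ∂μ) - F x‖ < ε := by
  have := isCompact_iff_compactSpace.mp hK
  let g : C(E, C(K, G)) :=
    ContinuousMap.curry ⟨fun q : E × K => F (q.2 - q.1), by fun_prop⟩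
  have hlim := tendsto_setIntegral_pow_smul_of_unique_maximum_of_isCompact_of_continuousOn
    (μ := μ) hS hc.continuousOn hmax hnonneg hpos
    (subset_closure (mem_interior_iff_mem_nhds.mpr hS₀)) g.continuous.continuousOn
  filter_upwards [Metric.tendsto_nhds.mp hlim ε hε] with k hk x hx
  have hint : IntegrableOn (fun y => c y ^ k • g y) S μ :=
    ((hc.pow k).smul g.continuous).continuousOn.integrableOn_compact hS
  have hdist := (ContinuousMap.dist_apply_le_dist (⟨x, hx⟩ : K)).trans_lt hk
  rw [dist_eq_norm] at hdist
  have heval := (ContinuousMap.evalCLM ℝ (⟨x, hx⟩ : K)).integral_comp_comm hint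
  simp only [ContinuousMap.evalCLM_apply, ContinuousMap.smul_apply] at heval
  simpa [← heval, g] using hdist

/-- Convolving a compactly supported continuous function with a polynomial gives a polynomial. -/
theorem MvPolynomial.exists_eval_eq_integral_sub
    {ι E : Type*} [NormedAddCommGroup E] [NormedSpace ℝ E] [MeasurableSpace E] [BorelSpace E]
    (μ : Measure E) [IsFiniteMeasureOnCompacts μ] (L : E →L[ℝ] (ι → ℝ))
    (q : MvPolynomial ι ℝ) {F : E → ℝ} (hF : Continuous F) (hFc : HasCompactSupport F) :
    ∃ p : MvPolynomial ι ℝ, ∀ x,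
      MvPolynomial.eval (L x) p = ∫ y, MvPolynomial.eval (L (x - y)) q * F y ∂μ := by
  have hint : ∀ (r : MvPolynomial ι ℝ) {H : E → ℝ}, Continuous H → HasCompactSupport H →
      ∀ x, Integrable (fun y => MvPolynomial.eval (L (x - y)) r * H y) μ := by
    intro r H hH hHc x
    refine Continuous.integrable_of_hasCompactSupport ?_ hHc.mul_left
    exact ((MvPolynomial.continuous_eval r).comp (by fun_prop)).mul hH
  induction q using MvPolynomial.induction_on generalizing F with
  | C a => exact ⟨MvPolynomial.C (∫ y, a * F y ∂μ), fun x => by simp⟩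
  | add q₁ q₂ h₁ h₂ =>
    obtain ⟨p₁, hp₁⟩ := h₁ hF hFc
    obtain ⟨p₂, hp₂⟩ := h₂ hF hFc
    refine ⟨p₁ + p₂, fun x => ?_⟩
    simp only [map_add, add_mul, hp₁, hp₂]
    exact (integral_add (hint q₁ hF hFc x) (hint q₂ hF hFc x)).symm
  | mul_X q i h =>
    have hG : Continuous fun y => L y i * F y := by fun_prop
    have hGc : HasCompactSupport fun y => L y i * F y := hFc.mul_left
    obtain ⟨p₁, hp₁⟩ := h hF hFc
    obtain ⟨p₂, hp₂⟩ := h hG hGc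
    refine ⟨p₁ * MvPolynomial.X i - p₂, fun x => ?_⟩
    rw [map_sub, map_mul, MvPolynomial.eval_X, hp₁, hp₂]
    rw [← integral_mul_const, ← integral_sub ((hint q hF hFc x).mul_const _) (hint q hG hGc x)]
    congr with y
    simp only [map_sub, map_mul, MvPolynomial.eval_X, Pi.sub_apply]
    ring

/-- Polynomials are dense in `C¹` functions on compact subsets of a finite-dimensional space, for
the topology of uniform convergence of the function and its derivative. -/
theorem ContDiff.exists_mvPolynomial_near_on_compact
    {ι E : Type*} [Fintype ι] [NormedAddCommGroup E] [NormedSpace ℝ E] [FiniteDimensional ℝ E]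
    (L : E →L[ℝ] (ι → ℝ)) (hL : Function.Injective L)
    {v : E → ℝ} (hv : ContDiff ℝ 1 v) {K : Set E} (hK : IsCompact K) {ε : ℝ} (hε : 0 < ε) :
    ∃ p : MvPolynomial ι ℝ, ∀ x ∈ K,
      |MvPolynomial.eval (L x) p - v x| < ε ∧
      ‖fderiv ℝ (fun y => MvPolynomial.eval (L y) p) x - fderiv ℝ v x‖ < ε := by
  borelize E
  let μ : Measure E := Measure.addHaar
  obtain ⟨r, hr, hKr⟩ := hK.isBounded.subset_ball_lt 0 (0 : E)
  let χ : ContDiffBump (0 : E) := ⟨r, r + 1, hr, by linarith⟩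
  let F : E → ℝ := fun x => χ x * v x
  have hF : ContDiff ℝ 1 F := χ.contDiff.mul hv
  have hFc : HasCompactSupport F := χ.hasCompactSupport.mul_right
  have hFv : ∀ x ∈ Metric.ball (0 : E) r, F x = v x := fun x hx => by
    simp [F, χ.one_of_mem_closedBall (Metric.ball_subset_closedBall hx)]
  have hF₀ : ∀ x, r + 1 ≤ ‖x‖ → F x = 0 := fun x hx => by
    simp [F, χ.zero_of_le_dist (x := x) (by simpa [χ] using hx)]
  set S : Set E := Metric.closedBall 0 (2 * r + 1) with hSdef
  have hS : IsCompact S := isCompact_closedBall _ _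
  obtain ⟨M, hM⟩ := hS.exists_bound_of_continuousOn
    (f := fun y => ∑ i, L y i ^ 2) (by fun_prop)
  let Q : MvPolynomial ι ℝ := MvPolynomial.C (|M| + 1) - ∑ i, MvPolynomial.X i ^ 2
  let c : E → ℝ := fun y => MvPolynomial.eval (L y) Q
  have hc_eq : ∀ y, c y = |M| + 1 - ∑ i, L y i ^ 2 := fun y => by simp [c, Q]
  have hc : Continuous c := (MvPolynomial.continuous_eval Q).comp L.continuous
  have hc₀ : c 0 = |M| + 1 := by simp [hc_eq]
  have hmax : ∀ y ∈ S, y ≠ 0 → c y < c 0 := by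
    intro y _ hy
    rw [hc₀, hc_eq]
    have hLy : L y ≠ 0 := (map_ne_zero_iff L hL).mpr hy
    obtain ⟨i, hi⟩ := Function.ne_iff.mp hLy
    have : 0 < ∑ i, L y i ^ 2 :=
      Finset.sum_pos' (fun _ _ => sq_nonneg _) ⟨i, Finset.mem_univ i, sq_pos_of_ne_zero hi⟩
    linarith
  have hnonneg : ∀ y ∈ S, 0 ≤ c y := by
    intro y hy
    have := (le_abs_self _).trans (hM y hy)
    rw [hc_eq]
    linarith [le_abs_self M]
  have hpos : 0 < c 0 := by rw [hc₀]; positivity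
  have hS₀ : S ∈ 𝓝 (0 : E) := Metric.closedBall_mem_nhds _ (by linarith)
  obtain ⟨k, hk₁, hk₂⟩ :=
    ((eventually_norm_setIntegral_pow_smul_sub_lt μ hS hK hS₀ hc hmax hnonneg hpos
      hF.continuous hε).and
    (eventually_norm_setIntegral_pow_smul_sub_lt μ hS hK hS₀ hc hmax hnonneg hpos
      (hF.continuous_fderiv one_ne_zero) hε)).exists
  set a : ℝ := (∫ y in S, c y ^ k ∂μ)⁻¹
  obtain ⟨p, hp⟩ := MvPolynomial.exists_eval_eq_integral_sub μ L (Q ^ k) hF.continuous hFc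
  have hp_eq : ∀ x ∈ Metric.ball (0 : E) r,
      MvPolynomial.eval (L x) p = ∫ y in S, c y ^ k • F (x - y) ∂μ := by
    intro x hx
    rw [hp, ← integral_sub_left_eq_self _ μ x, ← integral_indicator hS.measurableSet]
    congr with y
    by_cases hy : y ∈ S
    · simp [hy, c]
    · have hxy : F (x - y) = 0 := by
        apply hF₀
        simp only [hSdef, mem_closedBall_zero_iff, not_le] at hy
        rw [mem_ball_zero_iff] at hx
        linarith [norm_sub_norm_le y x, norm_sub_rev x y]
      simp [hy, hxy]
  have hderiv : ∀ x, HasFDerivAt (fun x => ∫ y in S, c y ^ k • F (x - y) ∂μ)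
      (∫ y in S, c y ^ k • fderiv ℝ F (x - y) ∂μ) x := by
    intro x
    have hloc : LocallyIntegrable (S.indicator fun y => c y ^ k) μ :=
      ((integrable_indicator_iff hS.measurableSet).mpr
        ((hc.pow k).continuousOn.integrableOn_compact hS)).locallyIntegrable
    have h := hFc.hasFDerivAt_convolution_right (ContinuousLinearMap.lsmul ℝ ℝ) hloc hF x
    have h_fun : (fun x => ∫ y in S, c y ^ k • F (x - y) ∂μ) =
        convolution (S.indicator fun y => c y ^ k) F (ContinuousLinearMap.lsmul ℝ ℝ) μ := by
      ext z
      rw [convolution_def, ← integral_indicator hS.measurableSet]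
      congr with y
      by_cases hy : y ∈ S <;> simp [hy]
    have h_deriv : ∫ y in S, c y ^ k • fderiv ℝ F (x - y) ∂μ =
        convolution (S.indicator fun y => c y ^ k) (fderiv ℝ F)
          ((ContinuousLinearMap.lsmul ℝ ℝ).precompR E) μ x := by
      rw [convolution_def, ← integral_indicator hS.measurableSet]
      congr with y
      by_cases hy : y ∈ S <;> simp [hy, ContinuousLinearMap.precompR_apply]
    rw [h_fun, h_deriv]
    exact h
  refine ⟨MvPolynomial.C a * p, fun x hx => ?_⟩
  have hxr := hKr hx
  have hball : Metric.ball (0 : E) r ∈ 𝓝 x := Metric.isOpen_ball.mem_nhds hxr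
  have hfderiv_p : fderiv ℝ (fun y => MvPolynomial.eval (L y) (MvPolynomial.C a * p)) x =
      a • ∫ y in S, c y ^ k • fderiv ℝ F (x - y) ∂μ := by
    refine HasFDerivAt.fderiv (((hderiv x).const_smul a).congr_of_eventuallyEq ?_)
    filter_upwards [hball] with z hz
    simp [hp_eq z hz]
  have hfderiv_v : fderiv ℝ v x = fderiv ℝ F x :=
    Filter.EventuallyEq.fderiv_eq (by filter_upwards [hball] with z hz using (hFv z hz).symm)
  constructor
  · simpa [hp_eq x hxr, ← hFv x hxr] using hk₁ x hx
  · rw [hfderiv_p, hfderiv_v]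
    exact hk₂ x hx


/-- Theorem B.2 of the paper: if a `C¹` strict time-dependent barrier
function for the single integrator `ẋ = u` with unit-box controls exists on
compact sets, then a polynomial strict barrier function (in the `n+1`
variables `t, x₁, …, x_n`) also exists. -/
theorem polynomial_barrier_exists {n : ℕ} (T : ℝ) (hT : 0 < T)
    (X₀ X₁ X : Set (EuclideanSpace ℝ (Fin n)))
    (hX₀c : IsCompact X₀) (hX₁c : IsCompact X₁) (hXc : IsCompact X)
    (hX₀ne : X₀.Nonempty) (hX₀X : X₀ ⊆ X) (hX₁X : X₁ ⊆ X)
    (v : ℝ × EuclideanSpace ℝ (Fin n) → ℝ) (hv : ContDiff ℝ 1 v)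
    (hv₀ : ∀ x ∈ X₀, 0 < v (0, x))
    (hv₁ : ∀ x ∈ X₁, v (T, x) < 0)
    (hlie : ∀ t ∈ Set.Icc (0 : ℝ) T, ∀ x ∈ X, ∀ u : EuclideanSpace ℝ (Fin n),
      (∀ i, |u i| ≤ 1) → 0 < fderiv ℝ v (t, x) (1, u)) :
    ∃ p : MvPolynomial (Fin (n + 1)) ℝ,
      (∀ x ∈ X₀, 0 < MvPolynomial.eval (Fin.cons 0 (fun i => x i)) p) ∧
      (∀ x ∈ X₁, MvPolynomial.eval (Fin.cons T (fun i => x i)) p < 0) ∧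
      (∀ t ∈ Set.Icc (0 : ℝ) T, ∀ x ∈ X, ∀ u : EuclideanSpace ℝ (Fin n),
        (∀ i, |u i| ≤ 1) →
        0 < fderiv ℝ (fun q : ℝ × EuclideanSpace ℝ (Fin n) =>
          MvPolynomial.eval (Fin.cons q.1 (fun i => q.2 i)) p) (t, x) (1, u)) := by
  let L : ℝ × EuclideanSpace ℝ (Fin n) →L[ℝ] (Fin (n + 1) → ℝ) :=
    ContinuousLinearMap.pi (Fin.cons (ContinuousLinearMap.fst ℝ ℝ _)
      (fun i => (EuclideanSpace.proj i).comp (ContinuousLinearMap.snd ℝ ℝ _)))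
  have hL_eq : ∀ q, L q = Fin.cons q.1 (fun i => q.2 i) := fun q => by
    ext j
    refine Fin.cases ?_ (fun i => ?_) j <;> simp [L]
  have hL : Function.Injective L := by
    intro q q' h
    rw [hL_eq, hL_eq, Fin.cons_inj] at h
    exact Prod.ext h.1 (by ext i; exact congrFun h.2 i)
  have hU : IsCompact {u : EuclideanSpace ℝ (Fin n) | ∀ i, |u i| ≤ 1} := by
    have h := (EuclideanSpace.equiv (Fin n) ℝ).toHomeomorph.isCompact_preimage.mpr
      (isCompact_univ_pi fun _ : Fin n => isCompact_Icc (a := (-1 : ℝ)) (b := 1))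
    convert h using 1
    ext u
    simp [abs_le, Pi.le_def, forall_and]
  obtain ⟨m₀, hm₀, hv₀'⟩ := hX₀c.exists_forall_le' (f := fun x => v (0, x))
    (hv.continuous.comp (by fun_prop)).continuousOn hv₀
  obtain ⟨m₁, hm₁, hv₁'⟩ := hX₁c.exists_forall_le' (f := fun x => -v (T, x)) (a := 0)
    (hv.continuous.comp (by fun_prop)).neg.continuousOn fun x hx => neg_pos.mpr (hv₁ x hx)
  obtain ⟨m₂, hm₂, hlie'⟩ := ((isCompact_Icc (a := (0 : ℝ)) (b := T)).prod
      (hXc.prod hU)).exists_forall_le' (a := 0)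
    (f := fun z : ℝ × EuclideanSpace ℝ (Fin n) × EuclideanSpace ℝ (Fin n) =>
      fderiv ℝ v (z.1, z.2.1) (1, z.2.2))
    (((hv.continuous_fderiv one_ne_zero).comp (by fun_prop)).clm_apply
      (by fun_prop)).continuousOn
    fun z hz => hlie z.1 hz.1 z.2.1 hz.2.1 z.2.2 hz.2.2
  obtain ⟨B, hB⟩ := hU.exists_bound_of_continuousOn
    (f := fun u => ((1 : ℝ), u)) (by fun_prop)
  have hB₁ : 0 < |B| + 1 := by positivity
  obtain ⟨p, hp⟩ := hv.exists_mvPolynomial_near_on_compact L hL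
    ((isCompact_Icc (a := (0 : ℝ)) (b := T)).prod hXc)
    (lt_min hm₀ (lt_min hm₁ (div_pos hm₂ hB₁)))
  simp only [hL_eq, lt_min_iff] at hp
  refine ⟨p, fun x hx => ?_, fun x hx => ?_, fun t ht x hx u hu => ?_⟩
  · have h := (abs_lt.mp (hp (0, x) ⟨⟨le_rfl, hT.le⟩, hX₀X hx⟩).1.1).1
    have := hv₀' x hx
    simp only at h this
    linarith
  · have h := (abs_lt.mp (hp (T, x) ⟨⟨hT.le, le_rfl⟩, hX₁X hx⟩).1.2.1).2
    have := hv₁' x hx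
    simp only at h this
    linarith
  · have h := (hp (t, x) ⟨ht, hx⟩).2.2.2
    have hm := hlie' (t, x, u) ⟨ht, hx, hu⟩
    set D := fderiv ℝ (fun q : ℝ × EuclideanSpace ℝ (Fin n) =>
      MvPolynomial.eval (Fin.cons q.1 (fun i => q.2 i)) p) (t, x)
    have hnorm : ‖((1 : ℝ), u)‖ < |B| + 1 := by linarith [hB u hu, le_abs_self B]
    have hle : |(D - fderiv ℝ v (t, x)) (1, u)| < m₂ :=
      calc |(D - fderiv ℝ v (t, x)) (1, u)|
          ≤ ‖D - fderiv ℝ v (t, x)‖ * ‖((1 : ℝ), u)‖ := (D - fderiv ℝ v (t, x)).le_opNorm _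
        _ ≤ ‖D - fderiv ℝ v (t, x)‖ * (|B| + 1) := by gcongr
        _ < m₂ := (lt_div_iff₀ hB₁).mp h
    have hlt := (abs_lt.mp hle).1
    rw [sub_apply] at hlt
    simp only at hm
    linarith
end
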